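/- arXiv:1810.07072 — 9 statements merged into one kernel-verified Lean document; each statement's English description precedes it below -/
import Mathlib

section
/- Let n ≥ 1 and let G be a simple graph on the vertex set Fin n. Suppose G has an L-representation: there are functions ℓ, b, r, t : Fin n → ℝ with ℓ v < r v and b v < t v for every vertex v, such that for all distinct vertices v, w the rotated-L curves C(ℓ v, b v, r v, t v) and C(ℓ w, b w, r w, t w) have nonempty intersection if and only if v and w are adjacent in G. Then G has a segment representation of resolution 4^n: there exist functions p, q : Fin n → ℝ × ℝ such that both coordinates of every point p v and q v are integers lying in the interval [0, 4^n], and for all distinct vertices v, w, segment[p v, q v] ∩ segment[p w, q w] ≠ ∅ if and only if v and w are adjacent in G. -/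
/-- The rotated-L curve: top and right sides of the rectangle `[l,r] × [b,t]`. -/
def rotL (l b r t : ℝ) : Set (ℝ × ℝ) :=
  segment ℝ (l, t) (r, t) ∪ segment ℝ (r, b) (r, t)

lemma mem_rotL_iff {l b r t : ℝ} (hlr : l ≤ r) (hbt : b ≤ t) (z : ℝ × ℝ) :
    z ∈ rotL l b r t ↔ (z.2 = t ∧ l ≤ z.1 ∧ z.1 ≤ r) ∨ (z.1 = r ∧ b ≤ z.2 ∧ z.2 ≤ t) := by
  obtain ⟨x, y⟩ := z
  rw [rotL, ← Prod.image_mk_segment_left, ← Prod.image_mk_segment_right, segment_eq_Icc hlr,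
    segment_eq_Icc hbt]
  simp only [Set.mem_union, Set.mem_image, Set.mem_Icc, Prod.mk.injEq]
  grind

lemma rotL_inter_nonempty_iff {l b r t l' b' r' t' : ℝ} (hlr : l ≤ r) (hbt : b ≤ t)
    (hlr' : l' ≤ r') (hbt' : b' ≤ t') :
    (rotL l b r t ∩ rotL l' b' r' t').Nonempty ↔
      (r ≤ r' ∧ t' ≤ t ∧ l' ≤ r ∧ b ≤ t') ∨ (r' ≤ r ∧ t ≤ t' ∧ l ≤ r' ∧ b' ≤ t) := by
  constructor
  · rintro ⟨z, hz, hz'⟩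
    rw [mem_rotL_iff hlr hbt] at hz
    rw [mem_rotL_iff hlr' hbt'] at hz'
    grind
  · rintro (h | h)
    · refine ⟨(r, t'), ?_, ?_⟩
      · rw [mem_rotL_iff hlr hbt]; grind
      · rw [mem_rotL_iff hlr' hbt']; grind
    · refine ⟨(r', t), ?_, ?_⟩
      · rw [mem_rotL_iff hlr hbt]; grind
      · rw [mem_rotL_iff hlr' hbt']; grind

/-- Replace the values of `f` by ranks, with ties broken by `g`, and thresholds `l` by ranks. -/
lemma exists_rank {ι α β : Type*} [Fintype ι] [LinearOrder α] [LinearOrder β]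
    (f l : ι → α) (g : ι → β) :
    ∃ x a : ι → ℕ, (∀ v, x v < Fintype.card ι) ∧
      (∀ v w, x v < x w ↔ f v < f w ∨ f v = f w ∧ g v < g w) ∧
      (∀ v w, a w ≤ x v ↔ l w ≤ f v) := by
  classical
  let k : ι → α ×ₗ β := fun v => toLex (f v, g v)
  have hk : ∀ v w, k v < k w ↔ f v < f w ∨ f v = f w ∧ g v < g w := fun v w =>
    Prod.Lex.toLex_lt_toLex
  have hlt : ∀ v w, k v < k w →
      (Finset.univ.filter fun u => k u < k v).card < (Finset.univ.filter fun u => k u < k w).card := by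
    intro v w h
    apply Finset.card_lt_card
    rw [Finset.ssubset_iff_of_subset]
    · exact ⟨v, by simpa using h, by simp⟩
    · intro u hu
      simp only [Finset.mem_filter, Finset.mem_univ, true_and] at hu ⊢
      exact hu.trans h
  refine ⟨fun v => (Finset.univ.filter fun u => k u < k v).card,
    fun v => (Finset.univ.filter fun u => f u < l v).card, fun v => ?_, fun v w => ?_,
    fun v w => ?_⟩
  · rw [← Finset.card_univ]
    apply Finset.card_lt_card
    rw [Finset.ssubset_iff_of_subset (Finset.subset_univ _)]
    exact ⟨v, by simp, by simp⟩
  · rw [← hk]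
    refine ⟨fun h => ?_, hlt v w⟩
    rcases lt_trichotomy (k v) (k w) with h' | h' | h'
    · exact h'
    · simp only [h', lt_self_iff_false] at h
    · exact absurd h (hlt w v h').asymm
  · refine ⟨fun h => ?_, fun h => ?_⟩
    · by_contra! hlt'
      refine h.not_gt (Finset.card_lt_card ?_)
      rw [Finset.ssubset_iff_of_subset]
      · exact ⟨v, by simpa using hlt', by simp⟩
      · intro u hu
        simp only [Finset.mem_filter, Finset.mem_univ, true_and, hk] at hu ⊢
        rcases hu with hu | hu
        · exact hu.trans hlt'
        · exact hu.1 ▸ hlt'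
    · apply Finset.card_le_card
      intro u hu
      simp only [Finset.mem_filter, Finset.mem_univ, true_and, hk] at hu ⊢
      exact Or.inl (hu.trans_le h)

lemma mem_segment_prod_iff {z : ℝ × ℝ} {A Y X C : ℝ} :
    z ∈ segment ℝ (A, Y) (X, C) ↔
      ∃ s, 0 ≤ s ∧ s ≤ 1 ∧ z.1 = A + s * (X - A) ∧ z.2 = Y - s * (Y - C) := by
  rw [segment_eq_image']
  simp only [Set.mem_image, Set.mem_Icc]
  constructor
  · rintro ⟨s, ⟨h0, h1⟩, rfl⟩
    refine ⟨s, h0, h1, by simp, ?_⟩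
    simp only [Prod.mk_sub_mk, Prod.smul_mk, smul_eq_mul, Prod.mk_add_mk]
    ring
  · rintro ⟨s, h0, h1, hx, hy⟩
    refine ⟨s, ⟨h0, h1⟩, Prod.ext ?_ ?_⟩
    · simp [hx]
    · simp only [Prod.mk_sub_mk, Prod.smul_mk, smul_eq_mul, Prod.mk_add_mk, hy]
      ring

/-- Two descending segments each of which separates the endpoints of the other one meet. -/
lemma segment_inter_nonempty_of_separates {A Y X C A' Y' X' C' : ℝ}
    (h1 : (Y - C) * (A' - A) + (X - A) * (Y' - Y) < 0)
    (h2 : 0 ≤ (Y - C) * (X' - A) + (X - A) * (C' - Y))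
    (h3 : (Y' - C') * (X - A') + (X' - A') * (C - Y') ≤ 0)
    (h4 : 0 ≤ (Y' - C') * (A - A') + (X' - A') * (Y - Y')) :
    (segment ℝ (A, Y) (X, C) ∩ segment ℝ (A', Y') (X', C')).Nonempty := by
  set D : ℝ := (Y - C) * (X' - A') - (X - A) * (Y' - C') with hD
  have hpos : 0 < D := by linarith
  set s : ℝ := ((Y' - C') * (A - A') + (X' - A') * (Y - Y')) / D with hs
  set u : ℝ := -((Y - C) * (A' - A) + (X - A) * (Y' - Y)) / D with hu
  refine ⟨(A + s * (X - A), Y - s * (Y - C)), mem_segment_prod_iff.2 ⟨s, ?_, ?_, rfl, rfl⟩,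
    mem_segment_prod_iff.2 ⟨u, ?_, ?_, ?_, ?_⟩⟩
  · exact div_nonneg h4 hpos.le
  · rw [hs, div_le_one hpos]; linarith
  · exact div_nonneg (by linarith) hpos.le
  · rw [hu, div_le_one hpos]; linarith
  · have hsD : s * D = _ := div_mul_cancel₀ _ hpos.ne'
    have huD : u * D = _ := div_mul_cancel₀ _ hpos.ne'
    apply mul_right_cancel₀ hpos.ne'
    simp only
    linear_combination (X - A) * hsD - (X' - A') * huD + (A - A') * hD
  · have hsD : s * D = _ := div_mul_cancel₀ _ hpos.ne'
    have huD : u * D = _ := div_mul_cancel₀ _ hpos.ne'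
    apply mul_right_cancel₀ hpos.ne'
    simp only
    linear_combination -(Y - C) * hsD + (Y' - C') * huD + (Y - Y') * hD

lemma descending_line_separates {A Y X C A' Y' X' C' : ℝ} (hA : 0 ≤ A) (hC' : 0 ≤ C')
    (hX : 0 < X) (hY : 0 < Y) (hAX : 2 * A ≤ X) (hXX : 4 * X ≤ X') (hYY : 4 * Y' ≤ Y)
    (hAX' : 2 * A' ≤ X) (hCY' : 2 * C ≤ Y') (hC : 0 ≤ C) :
    (Y - C) * (A' - A) + (X - A) * (Y' - Y) < 0 ∧
      0 ≤ (Y - C) * (X' - A) + (X - A) * (C' - Y) := by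
  have hYC : 0 < Y - C := by linarith
  have hXA : 0 < X - A := by linarith
  have hXY := mul_pos hX hY
  have hAY := mul_nonneg hA hY.le
  constructor
  · have e1 : (Y - C) * (A' - A) ≤ (Y - C) * (X / 2 - A) :=
      mul_le_mul_of_nonneg_left (by linarith) hYC.le
    have e2 : (Y - C) * (X / 2 - A) ≤ Y * (X / 2 - A) :=
      mul_le_mul_of_nonneg_right (by linarith) (by linarith)
    have e3 : (X - A) * (Y' - Y) ≤ (X - A) * (-(3 / 4) * Y) :=
      mul_le_mul_of_nonneg_left (by linarith) hXA.le
    nlinarith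
  · have e1 : (7 / 8 * Y) * (4 * X - A) ≤ (Y - C) * (X' - A) :=
      mul_le_mul (by linarith) (by linarith) (by linarith) hYC.le
    have e2 : (X - A) * (-Y) ≤ (X - A) * (C' - Y) :=
      mul_le_mul_of_nonneg_left (by linarith) hXA.le
    nlinarith

lemma segment_inter_nonempty_of_crossing {A Y X C A' Y' X' C' : ℝ} (hA : 0 ≤ A) (hC : 0 ≤ C)
    (hA' : 0 ≤ A') (hC' : 0 ≤ C') (hX : 0 < X) (hY' : 0 < Y')
    (hAX : 2 * A ≤ X) (hCY : 2 * C' ≤ Y') (hXX : 4 * X ≤ X') (hYY : 4 * Y' ≤ Y)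
    (hAX' : 2 * A' ≤ X) (hCY' : 2 * C ≤ Y') :
    (segment ℝ (A, Y) (X, C) ∩ segment ℝ (A', Y') (X', C')).Nonempty := by
  obtain ⟨h1, h2⟩ := descending_line_separates (X' := X') (C' := C') hA hC' hX (by linarith) hAX
    hXX hYY hAX' hCY' hC
  obtain ⟨h3, h4⟩ := descending_line_separates (A := C') (Y := X') (X := Y') (C := A') (A' := C)
    (Y' := X) (X' := Y) (C' := A) hC' hA hY' (by linarith) hCY hYY hXX hCY' hAX' hA'
  apply segment_inter_nonempty_of_separates h1 h2 <;> linarith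

lemma bounds_of_mem_segment {z : ℝ × ℝ} {A Y X C : ℝ} (hAX : A ≤ X) (hCY : C ≤ Y)
    (hz : z ∈ segment ℝ (A, Y) (X, C)) : A ≤ z.1 ∧ z.1 ≤ X ∧ C ≤ z.2 ∧ z.2 ≤ Y := by
  obtain ⟨s, h0, h1, hx, hy⟩ := mem_segment_prod_iff.1 hz
  rw [hx, hy]
  refine ⟨?_, ?_, ?_, ?_⟩ <;>
    nlinarith [mul_nonneg h0 (sub_nonneg.2 hAX), mul_nonneg h0 (sub_nonneg.2 hCY),
      mul_nonneg (sub_nonneg.2 h1) (sub_nonneg.2 hAX),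
      mul_nonneg (sub_nonneg.2 h1) (sub_nonneg.2 hCY)]

lemma not_mem_segment_of_small {z : ℝ × ℝ} {A Y X C : ℝ} (hA : 0 ≤ A) (hC : 0 ≤ C) (hX : 0 < X)
    (hY : 0 < Y) (hx : 4 * z.1 ≤ X) (hy : 4 * z.2 ≤ Y) : z ∉ segment ℝ (A, Y) (X, C) := by
  intro hz
  obtain ⟨s, h0, h1, hzx, hzy⟩ := mem_segment_prod_iff.1 hz
  have e1 : s ≤ 1 / 4 := by
    by_contra! h
    nlinarith [mul_nonneg (sub_nonneg.2 h1) hA]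
  nlinarith [mul_nonneg h0 hC]

/-- On exponentially growing coordinates, a line looks like a rotated L. -/
lemma exp_segment_inter_nonempty_iff {x y a c x' y' a' c' : ℕ}
    (hax : a ≤ x) (hcy : c ≤ y) (hax' : a' ≤ x') (hcy' : c' ≤ y') (hx : x < x') (hy : y ≠ y') :
    (segment ℝ ((2 * 4 ^ a, 4 ^ (y + 1)) : ℝ × ℝ) (4 ^ (x + 1), 2 * 4 ^ c) ∩
      segment ℝ ((2 * 4 ^ a', 4 ^ (y' + 1)) : ℝ × ℝ) (4 ^ (x' + 1), 2 * 4 ^ c')).Nonempty ↔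
      y' < y ∧ a' ≤ x ∧ c ≤ y' := by
  have hmono : ∀ {i j : ℕ}, i ≤ j → (4 : ℝ) ^ i ≤ 4 ^ j := fun h =>
    pow_le_pow_right₀ (by norm_num) h
  have hlt : ∀ {i j : ℕ}, i < j → 4 * (4 : ℝ) ^ i ≤ 4 ^ j := fun {i j} h => by
    have := hmono (Nat.succ_le_of_lt h)
    rw [Nat.succ_eq_add_one, pow_succ] at this
    linarith
  have hpos : ∀ i : ℕ, (0 : ℝ) < 4 ^ i := fun i => by positivity
  have := hmono hax
  have := hmono hcy
  have := hmono hax'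
  have := hmono hcy'
  have := hlt hx
  simp only [pow_succ]
  constructor
  · rintro ⟨z, hz, hz'⟩
    have hb := bounds_of_mem_segment (by linarith [hpos x]) (by linarith [hpos y]) hz
    have hb' := bounds_of_mem_segment (by linarith [hpos x']) (by linarith [hpos y']) hz'
    refine ⟨?_, ?_, ?_⟩
    · by_contra! h
      have := hlt (lt_of_le_of_ne h hy)
      exact not_mem_segment_of_small (by positivity) (by positivity) (by positivity)
        (by positivity) (by linarith) (by linarith) hz'
    · by_contra! h
      linarith [hlt h, hpos x]
    · by_contra! h
      linarith [hlt h, hpos y']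
  · rintro ⟨h1, h2, h3⟩
    have := hlt h1
    have := hmono h2
    have := hmono h3
    have := hpos x
    have := hpos y'
    apply segment_inter_nonempty_of_crossing <;> first | positivity | linarith

theorem segment_representation_of_L_representation
    (n : ℕ) (hn : 1 ≤ n) (G : SimpleGraph (Fin n))
    (l b r t : Fin n → ℝ)
    (hlr : ∀ v, l v < r v) (hbt : ∀ v, b v < t v)
    (hrep : ∀ v w : Fin n, v ≠ w →
      ((rotL (l v) (b v) (r v) (t v) ∩ rotL (l w) (b w) (r w) (t w)).Nonempty ↔ G.Adj v w)) :
    ∃ p q : Fin n → ℝ × ℝ,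
      (∀ v, ∃ z1 z2 z3 z4 : ℤ,
        (p v).1 = z1 ∧ (p v).2 = z2 ∧ (q v).1 = z3 ∧ (q v).2 = z4 ∧
        0 ≤ (p v).1 ∧ (p v).1 ≤ (4:ℝ)^n ∧
        0 ≤ (p v).2 ∧ (p v).2 ≤ (4:ℝ)^n ∧
        0 ≤ (q v).1 ∧ (q v).1 ≤ (4:ℝ)^n ∧
        0 ≤ (q v).2 ∧ (q v).2 ≤ (4:ℝ)^n) ∧
      (∀ v w : Fin n, v ≠ w →
        ((segment ℝ (p v) (q v) ∩ segment ℝ (p w) (q w)).Nonempty ↔ G.Adj v w)) := by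
  obtain ⟨x, a, hxn, hx, ha⟩ := exists_rank r l
    (fun v => (toLex (OrderDual.toDual (t v), v) : ℝᵒᵈ ×ₗ Fin n))
  obtain ⟨y, c, hyn, hy, hc⟩ := exists_rank t b
    (fun v => (toLex (OrderDual.toDual (r v), OrderDual.toDual v) : ℝᵒᵈ ×ₗ (Fin n)ᵒᵈ))
  simp only [Fintype.card_fin, Prod.Lex.toLex_lt_toLex, OrderDual.toDual_lt_toDual,
    OrderDual.toDual_inj] at hxn hx hyn hy
  have hax : ∀ v, a v ≤ x v := fun v => (ha v v).2 (hlr v).le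
  have hcy : ∀ v, c v ≤ y v := fun v => (hc v v).2 (hbt v).le
  have hne : ∀ v w, v ≠ w → x v ≠ x w ∧ y v ≠ y w := by
    intro v w hvw
    have h1 := hx v w
    have h2 := hx w v
    have h3 := hy v w
    have h4 := hy w v
    have := lt_or_gt_of_ne hvw
    grind
  have key : ∀ v w, x v < x w → (G.Adj v w ↔ y w < y v ∧ a w ≤ x v ∧ c v ≤ y w) := by
    intro v w hvw
    have hvw' : v ≠ w := fun h => by simp [h] at hvw
    rw [← hrep v w hvw', rotL_inter_nonempty_iff (hlr v).le (hbt v).le (hlr w).le (hbt w).le,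
      ha, hc, hy]
    rw [hx] at hvw
    have := hlr v
    have := hlr w
    have := hbt v
    have := hbt w
    grind
  refine ⟨fun v => (2 * 4 ^ a v, 4 ^ (y v + 1)), fun v => (4 ^ (x v + 1), 2 * 4 ^ c v),
    fun v => ?_, fun v w hvw => ?_⟩
  · have hpow : ∀ {i : ℕ}, i < n → (4 : ℝ) ^ (i + 1) ≤ 4 ^ n := fun h =>
      pow_le_pow_right₀ (by norm_num) h
    have hpow' : ∀ {i : ℕ}, i < n → 2 * (4 : ℝ) ^ i ≤ 4 ^ n := fun {i} h => by
      have := hpow h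
      have : (0 : ℝ) < 4 ^ i := by positivity
      rw [pow_succ] at *
      linarith
    exact ⟨2 * 4 ^ a v, 4 ^ (y v + 1), 4 ^ (x v + 1), 2 * 4 ^ c v, by push_cast; rfl,
      by push_cast; rfl, by push_cast; rfl, by push_cast; rfl, by positivity,
      hpow' ((hax v).trans_lt (hxn v)), by positivity, hpow (hyn v), by positivity, hpow (hxn v),
      by positivity, hpow' ((hcy v).trans_lt (hyn v))⟩
  · obtain ⟨h1, h2⟩ := hne v w hvw
    rcases lt_or_gt_of_ne h1 with h | h
    · rw [key v w h]
      exact exp_segment_inter_nonempty_iff (hax v) (hcy v) (hax w) (hcy w) h h2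
    · rw [G.adj_comm, key w v h, Set.inter_comm]
      exact exp_segment_inter_nonempty_iff (hax w) (hcy w) (hax v) (hcy v) h h2.symm
end

section
/- Let ℓ, b, r, t, L, B, R, T be natural numbers with ℓ < r, b < t, L < R, B < T, such that ℓ, r, L, R are pairwise distinct and b, t, B, T are pairwise distinct. If s(ℓ,b,r,t) ∩ s(L,B,R,T) ≠ ∅, then C(ℓ,b,r,t) ∩ C(L,B,R,T) ≠ ∅ (natural number parameters being viewed as real numbers in the curves C). -/
/-- The downward diagonal of the rectangle `[0,2^r] × [0,2^t]`. -/
def dseg (r t : ℕ) : Set (ℝ × ℝ) :=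
  segment ℝ (0, (2:ℝ)^t) ((2:ℝ)^r, 0)

/-- The segment `s(l,b,r,t)`: the downward diagonal pruned to the halfspaces
`x ≥ 2^l` and `y ≥ 2^b`. -/
def sseg (l b r t : ℕ) : Set (ℝ × ℝ) :=
  dseg r t ∩ {p : ℝ × ℝ | (2:ℝ)^l ≤ p.1} ∩ {p : ℝ × ℝ | (2:ℝ)^b ≤ p.2}

theorem add_div_eq_one_of_mem_dseg {r t : ℕ} {p : ℝ × ℝ} (hp : p ∈ dseg r t) :
    p.1 / 2 ^ r + p.2 / 2 ^ t = 1 := by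
  obtain ⟨u, v, -, -, huv, rfl⟩ := hp
  simp [← huv, add_comm]

theorem mem_segment_horizontal {a b x y : ℝ} (hax : a ≤ x) (hxb : x ≤ b) :
    (x, y) ∈ segment ℝ (a, y) (b, y) := by
  rw [← Prod.image_mk_segment_left, segment_eq_Icc (hax.trans hxb)]
  exact ⟨x, ⟨hax, hxb⟩, rfl⟩

theorem mem_segment_vertical {a b x y : ℝ} (hay : a ≤ y) (hyb : y ≤ b) :
    (x, y) ∈ segment ℝ (x, a) (x, b) := by
  rw [← Prod.image_mk_segment_right, segment_eq_Icc (hay.trans hyb)]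
  exact ⟨y, ⟨hay, hyb⟩, rfl⟩

/-- If pruned diagonals meet and the second rectangle extends further to the right, then the top
side of the second rectangle crosses the right side of the first. -/
theorem rotL_inter_nonempty_of_lt {l b r t L B R T : ℕ} (hrR : r < R)
    (h : (sseg l b r t ∩ sseg L B R T).Nonempty) :
    (rotL (l:ℝ) (b:ℝ) (r:ℝ) (t:ℝ) ∩ rotL (L:ℝ) (B:ℝ) (R:ℝ) (T:ℝ)).Nonempty := by
  obtain ⟨⟨x, y⟩, ⟨⟨hd, -⟩, hb⟩, ⟨⟨hD, hL⟩, -⟩⟩ := h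
  replace hd := add_div_eq_one_of_mem_dseg hd
  replace hD := add_div_eq_one_of_mem_dseg hD
  simp only [Set.mem_ofPred_eq] at hb hL hd hD
  have hx0 : 0 < x := lt_of_lt_of_le (by positivity) hL
  have hy0 : 0 < y := lt_of_lt_of_le (by positivity) hb
  have hLr : L < r := by
    have hxr : x / 2 ^ r < 1 := by
      have : 0 < y / 2 ^ t := by positivity
      linarith
    rw [div_lt_one (by positivity)] at hxr
    exact (pow_lt_pow_iff_right₀ one_lt_two).1 (hL.trans_lt hxr)
  have hbT : b < T := by
    have hyT : y / 2 ^ T < 1 := by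
      have : 0 < x / 2 ^ R := by positivity
      linarith
    rw [div_lt_one (by positivity)] at hyT
    exact (pow_lt_pow_iff_right₀ one_lt_two).1 (hb.trans_lt hyT)
  have hTt : T ≤ t := by
    by_contra! htT
    have hxlt : x / 2 ^ R < x / 2 ^ r :=
      div_lt_div_of_pos_left hx0 (by positivity) (pow_lt_pow_right₀ one_lt_two hrR)
    have hylt : y / 2 ^ T < y / 2 ^ t :=
      div_lt_div_of_pos_left hy0 (by positivity) (pow_lt_pow_right₀ one_lt_two htT)
    linarith
  exact ⟨((r : ℝ), (T : ℝ)),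
    Or.inr (mem_segment_vertical (by exact_mod_cast hbT.le) (by exact_mod_cast hTt)),
    Or.inl (mem_segment_horizontal (by exact_mod_cast hLr.le) (by exact_mod_cast hrR.le))⟩

theorem edge_of_sseg_intersect
    (l b r t L B R T : ℕ)
    (hlr : l < r) (hbt : b < t) (hLR : L < R) (hBT : B < T)
    (hx : ([l, r, L, R] : List ℕ).Pairwise (· ≠ ·))
    (hy : ([b, t, B, T] : List ℕ).Pairwise (· ≠ ·))
    (h : (sseg l b r t ∩ sseg L B R T).Nonempty) :
    (rotL (l:ℝ) (b:ℝ) (r:ℝ) (t:ℝ) ∩ rotL (L:ℝ) (B:ℝ) (R:ℝ) (T:ℝ)).Nonempty := by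
  have hne : r ≠ R := by
    simp only [List.pairwise_cons, List.mem_cons] at hx
    exact hx.2.1 R (by simp)
  rcases hne.lt_or_gt with hrR | hRr
  · exact rotL_inter_nonempty_of_lt hrR h
  · rw [Set.inter_comm] at h ⊢
    exact rotL_inter_nonempty_of_lt hRr h
end

section
/- Let ℓ, b, r, t, L, B, R, T be natural numbers with ℓ < r, b < t, L < R, B < T, such that ℓ, r, L, R are pairwise distinct and b, t, B, T are pairwise distinct. If C(ℓ,b,r,t) ∩ C(L,B,R,T) ≠ ∅ (natural number parameters being viewed as real numbers in the curves C), then s(ℓ,b,r,t) ∩ s(L,B,R,T) ≠ ∅. -/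
theorem mem_dseg_of_add_eq_one {r t : ℕ} {x y : ℝ} (hx : 0 ≤ x) (hy : 0 ≤ y)
    (h : x / 2 ^ r + y / 2 ^ t = 1) : (x, y) ∈ dseg r t := by
  refine ⟨y / 2 ^ t, x / 2 ^ r, by positivity, by positivity, by linarith, ?_⟩
  ext <;> simp

theorem two_pow_div_two_pow_le_half {m n : ℕ} (h : m < n) : (2 : ℝ) ^ m / 2 ^ n ≤ 1 / 2 := by
  have hle : (2 : ℝ) ^ (m + 1) ≤ 2 ^ n := pow_le_pow_right₀ (by norm_num) h
  rw [pow_succ] at hle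
  rw [div_le_div_iff₀ (by positivity) (by norm_num)]
  linarith

theorem two_pow_le_two_pow_mul {m n : ℕ} {u : ℝ} (h : m < n) (hu : 1 / 2 ≤ u) :
    (2 : ℝ) ^ m ≤ 2 ^ n * u := by
  have hle : (2 : ℝ) ^ (m + 1) ≤ 2 ^ n := pow_le_pow_right₀ (by norm_num) h
  rw [pow_succ] at hle
  nlinarith [pow_pos (two_pos : (0 : ℝ) < 2) n]

/-- The pruned diagonals meet when the top side of the first rectangle crosses the right side of
the second one. -/
theorem sseg_inter_nonempty_of_top_crosses_right {l b r t L B R T : ℕ} (hbt : b < t)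
    (hLR : L < R) (hlR : l < R) (hRr : R < r) (hBt : B < t) (htT : t < T) :
    (sseg l b r t ∩ sseg L B R T).Nonempty := by
  obtain ⟨a, ha⟩ : ∃ a : ℝ, a = 2 ^ R / 2 ^ r := ⟨_, rfl⟩
  obtain ⟨c, hc⟩ : ∃ c : ℝ, c = 2 ^ t / 2 ^ T := ⟨_, rfl⟩
  have ha0 : 0 < a := by rw [ha]; positivity
  have hc0 : 0 < c := by rw [hc]; positivity
  have ha1 : a ≤ 1 / 2 := ha ▸ two_pow_div_two_pow_le_half hRr
  have hc1 : c ≤ 1 / 2 := hc ▸ two_pow_div_two_pow_le_half htT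
  have hd : 0 < 1 - a * c := by nlinarith
  have hd1 : 0 < a * c := mul_pos ha0 hc0
  obtain ⟨u, hu⟩ : ∃ u : ℝ, u = (1 - c) / (1 - a * c) := ⟨_, rfl⟩
  obtain ⟨v, hv⟩ : ∃ v : ℝ, v = (1 - a) / (1 - a * c) := ⟨_, rfl⟩
  have hu2 : 1 / 2 ≤ u := by rw [hu, le_div_iff₀ hd]; linarith
  have hv2 : 1 / 2 ≤ v := by rw [hv, le_div_iff₀ hd]; linarith
  have h1 : a * u + v = 1 := by rw [hu, hv]; field_simp; ring
  have h2 : u + c * v = 1 := by rw [hu, hv, mul_div_assoc', ← add_div, div_eq_one_iff_eq hd.ne']; ring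
  have hx : (0 : ℝ) ≤ 2 ^ R * u := by positivity
  have hy : (0 : ℝ) ≤ 2 ^ t * v := by positivity
  have e1 : (2 : ℝ) ^ R * u / 2 ^ r + 2 ^ t * v / 2 ^ t = 1 := by
    rw [← h1, ha]; field_simp
  have e2 : (2 : ℝ) ^ R * u / 2 ^ R + 2 ^ t * v / 2 ^ T = 1 := by
    rw [← h2, hc]; field_simp
  exact ⟨(2 ^ R * u, 2 ^ t * v),
    ⟨⟨mem_dseg_of_add_eq_one hx hy e1, two_pow_le_two_pow_mul hlR hu2⟩,
      two_pow_le_two_pow_mul hbt hv2⟩,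
    ⟨⟨mem_dseg_of_add_eq_one hx hy e2, two_pow_le_two_pow_mul hLR hu2⟩,
      two_pow_le_two_pow_mul hBt hv2⟩⟩

theorem mem_rotL_cases {l b r t x y : ℝ} (hlr : l ≤ r) (hbt : b ≤ t)
    (h : (x, y) ∈ rotL l b r t) :
    (l ≤ x ∧ x ≤ r ∧ y = t) ∨ (x = r ∧ b ≤ y ∧ y ≤ t) := by
  rcases h with h | h
  · have h' := segment_subset_Icc (Prod.mk_le_mk.2 ⟨hlr, le_refl t⟩) h
    exact Or.inl ⟨h'.1.1, h'.2.1, le_antisymm h'.2.2 h'.1.2⟩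
  · have h' := segment_subset_Icc (Prod.mk_le_mk.2 ⟨le_refl r, hbt⟩) h
    exact Or.inr ⟨le_antisymm h'.2.1 h'.1.1, h'.1.2, h'.2.2⟩

theorem sseg_intersect_of_edge
    (l b r t L B R T : ℕ)
    (hlr : l < r) (hbt : b < t) (hLR : L < R) (hBT : B < T)
    (hx : ([l, r, L, R] : List ℕ).Pairwise (· ≠ ·))
    (hy : ([b, t, B, T] : List ℕ).Pairwise (· ≠ ·))
    (h : (rotL (l:ℝ) (b:ℝ) (r:ℝ) (t:ℝ) ∩ rotL (L:ℝ) (B:ℝ) (R:ℝ) (T:ℝ)).Nonempty) :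
    (sseg l b r t ∩ sseg L B R T).Nonempty := by
  obtain ⟨⟨x, y⟩, h₁, h₂⟩ := h
  simp only [List.pairwise_cons, List.mem_cons, List.not_mem_nil, or_false, forall_eq_or_imp,
    forall_eq] at hx hy
  have c₁ := mem_rotL_cases (by exact_mod_cast hlr.le) (by exact_mod_cast hbt.le) h₁
  have c₂ := mem_rotL_cases (by exact_mod_cast hLR.le) (by exact_mod_cast hBT.le) h₂
  rcases c₁ with ⟨hl, hr, rfl⟩ | ⟨rfl, hb, ht⟩ <;>
    rcases c₂ with ⟨hL, hR, hT⟩ | ⟨hR, hB, hT⟩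
  · norm_cast at hT
    omega
  · subst hR
    norm_cast at hl hr hB hT
    apply sseg_inter_nonempty_of_top_crosses_right <;> omega
  · subst hT
    norm_cast at hb ht hL hR
    rw [Set.inter_comm]
    apply sseg_inter_nonempty_of_top_crosses_right <;> omega
  · norm_cast at hR
    omega
end

section
/- Let ℓ, b, r, t be natural numbers with ℓ < r and b < t. Then s(ℓ,b,r,t) is exactly the closed segment from the point (2^ℓ, 2^t − 2^{t−(r−ℓ)}) to the point (2^r − 2^{r−(t−b)}, 2^b), where the powers 2^{t−(r−ℓ)} and 2^{r−(t−b)} are real powers of 2 with (possibly negative) integer exponents t − r + ℓ and r − t + b. -/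
/-- The point `(R * θ, T - T * θ)` of the diagonal of the rectangle `[0, R] × [0, T]`. -/
theorem lineMap_diagonal (R T θ : ℝ) :
    AffineMap.lineMap ((0, T) : ℝ × ℝ) (R, 0) θ = (R * θ, T - T * θ) := by
  ext <;> simp [AffineMap.lineMap_apply] <;> ring

/-- Pruning the diagonal of `[0, R] × [0, T]` to `x ≥ R * u` and `y ≥ T * v` leaves a segment. -/
theorem segment_diagonal_inter_halfspaces {R T u v : ℝ} (hR : 0 < R) (hT : 0 < T)
    (hu : 0 ≤ u) (hv : 0 ≤ v) (huv : u + v ≤ 1) :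
    segment ℝ ((0, T) : ℝ × ℝ) (R, 0) ∩ {p | R * u ≤ p.1} ∩ {p | T * v ≤ p.2} =
      segment ℝ (R * u, T - T * u) (R - R * v, T * v) := by
  have hend : ((R - R * v, T * v) : ℝ × ℝ) =
      AffineMap.lineMap ((0, T) : ℝ × ℝ) (R, 0) (1 - v) := by
    rw [lineMap_diagonal]
    ext <;> simp <;> ring
  rw [hend, ← lineMap_diagonal, ← image_segment, segment_eq_Icc (by linarith : u ≤ 1 - v),
    segment_eq_image_lineMap]
  ext p
  constructor
  · rintro ⟨⟨⟨θ, -, rfl⟩, h₁⟩, h₂⟩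
    simp only [Set.mem_ofPred_eq, lineMap_diagonal] at h₁ h₂
    refine ⟨θ, ⟨le_of_mul_le_mul_left h₁ hR, ?_⟩, rfl⟩
    have : v ≤ 1 - θ := le_of_mul_le_mul_left (by linarith) hT
    linarith
  · rintro ⟨θ, ⟨h₁, h₂⟩, rfl⟩
    refine ⟨⟨⟨θ, ⟨by linarith, by linarith⟩, rfl⟩, ?_⟩, ?_⟩ <;>
      simp only [Set.mem_ofPred_eq, lineMap_diagonal]
    · gcongr
    · nlinarith

/-- Distinct powers of two differ by a factor of at least two. -/
theorem two_zpow_sub_le_half {m n : ℕ} (h : m < n) : (2 : ℝ) ^ ((m : ℤ) - n) ≤ 1 / 2 := by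
  calc (2 : ℝ) ^ ((m : ℤ) - n) ≤ 2 ^ (-1 : ℤ) := zpow_le_zpow_right₀ one_le_two (by lia)
    _ = 1 / 2 := by norm_num

theorem two_pow_mul_zpow (n : ℕ) (k : ℤ) : (2 : ℝ) ^ n * 2 ^ k = 2 ^ ((n : ℤ) + k) := by
  rw [zpow_add₀ two_ne_zero, zpow_natCast]

theorem sseg_eq_segment (l b r t : ℕ) (hlr : l < r) (hbt : b < t) :
    sseg l b r t =
      segment ℝ
        (((2:ℝ)^l, (2:ℝ)^t - (2:ℝ)^((t:ℤ) - ((r:ℤ) - (l:ℤ)))) : ℝ × ℝ)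
        (((2:ℝ)^r - (2:ℝ)^((r:ℤ) - ((t:ℤ) - (b:ℤ))), (2:ℝ)^b) : ℝ × ℝ) := by
  have hx : (2 : ℝ) ^ l = 2 ^ r * 2 ^ ((l : ℤ) - r) := by
    rw [two_pow_mul_zpow, add_sub_cancel, zpow_natCast]
  have hy : (2 : ℝ) ^ b = 2 ^ t * 2 ^ ((b : ℤ) - t) := by
    rw [two_pow_mul_zpow, add_sub_cancel, zpow_natCast]
  have hy' : (2 : ℝ) ^ ((t : ℤ) - (r - l)) = 2 ^ t * 2 ^ ((l : ℤ) - r) := by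
    rw [two_pow_mul_zpow]
    congr 1
    ring
  have hx' : (2 : ℝ) ^ ((r : ℤ) - (t - b)) = 2 ^ r * 2 ^ ((b : ℤ) - t) := by
    rw [two_pow_mul_zpow]
    congr 1
    ring
  rw [sseg, dseg, hx', hy', hx, hy]
  exact segment_diagonal_inter_halfspaces (by positivity) (by positivity) (by positivity)
    (by positivity) (by linarith [two_zpow_sub_le_half hlr, two_zpow_sub_le_half hbt])
end

section
/- Let r, t, R, T be integers with r < R and T < t. Consider the two lines in the plane L₁ = {(x,y) : y = 2^t − 2^{t−r}·x} and L₂ = {(x,y) : y = 2^T − 2^{T−R}·x}, where all powers of 2 are real powers with integer exponents. Then L₁ and L₂ intersect in exactly one point (x*, y*), and this point satisfies x* ≥ 2^{r−1} and y* ≥ 2^{T−1}. -/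
theorem two_mul_zpow_le_of_lt {m n : ℤ} (h : m < n) : 2 * (2:ℝ)^m ≤ (2:ℝ)^n := by
  rw [← zpow_one_add₀ (two_ne_zero)]
  exact zpow_le_zpow_right₀ one_le_two (by omega)

/-- The lines with intercepts `(a, 0)`, `(0, b)` and `(A, 0)`, `(0, B)` meet in one point,
which is at least `(a / 2, B / 2)`. -/
theorem lines_intersect_of_two_mul_le {a b A B : ℝ} (ha : 0 < a) (hB : 0 < B)
    (haA : 2 * a ≤ A) (hBb : 2 * B ≤ b) :
    ∃ p : ℝ × ℝ,
      ({q : ℝ × ℝ | q.2 = b - b / a * q.1} ∩ {q : ℝ × ℝ | q.2 = B - B / A * q.1}) = {p} ∧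
      a / 2 ≤ p.1 ∧ B / 2 ≤ p.2 := by
  have hA : 0 < A := by linarith
  have hb : 0 < b := by linarith
  have hD : 0 < b * A - a * B := by nlinarith [mul_pos ha hB]
  refine ⟨(a * A * (b - B) / (b * A - a * B), b * B * (A - a) / (b * A - a * B)), ?_, ?_, ?_⟩
  · ext ⟨x, y⟩
    simp only [Set.mem_inter_iff, Set.mem_ofPred_eq, Set.mem_singleton_iff, Prod.mk.injEq]
    constructor
    · rintro ⟨h₁, h₂⟩
      field_simp at h₁ h₂
      rw [eq_div_iff hD.ne', eq_div_iff hD.ne']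
      constructor
      · linear_combination A * h₁ - a * h₂
      · linear_combination b * h₂ - B * h₁
    · rintro ⟨rfl, rfl⟩
      generalize hE : b * A - a * B = D at hD
      constructor
      · field_simp
        linear_combination hE
      · field_simp
        linear_combination hE
  · rw [le_div_iff₀ hD]
    nlinarith [mul_nonneg (mul_nonneg ha.le hA.le) (sub_nonneg.2 hBb), mul_pos (mul_pos ha ha) hB]
  · rw [le_div_iff₀ hD]
    nlinarith [mul_nonneg (mul_nonneg hb.le hB.le) (sub_nonneg.2 haA), mul_pos (mul_pos ha hB) hB]

theorem lines_intersect_in_good_region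
    (r t R T : ℤ) (hrR : r < R) (hTt : T < t) :
    ∃ p : ℝ × ℝ,
      ({q : ℝ × ℝ | q.2 = (2:ℝ)^t - (2:ℝ)^(t - r) * q.1} ∩
       {q : ℝ × ℝ | q.2 = (2:ℝ)^T - (2:ℝ)^(T - R) * q.1}) = {p} ∧
      (2:ℝ)^(r - 1) ≤ p.1 ∧ (2:ℝ)^(T - 1) ≤ p.2 := by
  simp only [zpow_sub₀ (two_ne_zero (α := ℝ)), zpow_one]
  exact lines_intersect_of_two_mul_le (by positivity) (by positivity)
    (two_mul_zpow_le_of_lt hrR) (two_mul_zpow_le_of_lt hTt)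
end

section
/- Let n ≥ 1 be a natural number. Let ℓ, b, r, t and L, B, R, T be natural numbers, all at most 2n−1, with ℓ < r, b < t, L < R, B < T, such that ℓ, r, L, R are pairwise distinct and b, t, B, T are pairwise distinct, and let σ, τ ∈ Bool. Write S₁ := Dₙ(ℓ,b,r,t) and K₁ := C(ℓ,b,r,t) if σ = false, and S₁ := Uₙ(ℓ,b,r,t) and K₁ := C'(ℓ,b,r,t) if σ = true; similarly write S₂ := Dₙ(L,B,R,T) and K₂ := C(L,B,R,T) if τ = false, and S₂ := Uₙ(L,B,R,T) and K₂ := C'(L,B,R,T) if τ = true. If K₁ ∩ K₂ ≠ ∅, then S₁ ∩ S₂ ≠ ∅. -/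
/-- The rotated-⅃ curve: top and left sides of the rectangle `[l,r] × [b,t]`. -/
def rotL' (l b r t : ℝ) : Set (ℝ × ℝ) :=
  segment ℝ (l, t) (r, t) ∪ segment ℝ (l, b) (l, t)

/-- The downward diagonal of the rectangle `[l,r] × [(2n)^b,(2n)^t]`. -/
def Dn (n l b r t : ℕ) : Set (ℝ × ℝ) :=
  segment ℝ ((l:ℝ), (2 * (n:ℝ))^t) ((r:ℝ), (2 * (n:ℝ))^b)

/-- The upward diagonal of the rectangle `[l,r] × [(2n)^b,(2n)^t]`. -/
def Un (n l b r t : ℕ) : Set (ℝ × ℝ) :=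
  segment ℝ ((l:ℝ), (2 * (n:ℝ))^b) ((r:ℝ), (2 * (n:ℝ))^t)

/-- The height at abscissa `x` of the line through `(l, u)` and `(r, v)`. -/
noncomputable def chordHeight (l r u v x : ℝ) : ℝ := (u * (r - x) + v * (x - l)) / (r - l)

theorem chordHeight_left {l r : ℝ} (h : l < r) (u v : ℝ) : chordHeight l r u v l = u := by
  have : r - l ≠ 0 := by linarith
  simp [chordHeight, this]

theorem chordHeight_right {l r : ℝ} (h : l < r) (u v : ℝ) : chordHeight l r u v r = v := by
  have : r - l ≠ 0 := by linarith
  simp [chordHeight, this]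

theorem continuous_chordHeight (l r u v : ℝ) : Continuous (chordHeight l r u v) := by
  unfold chordHeight
  fun_prop

theorem mk_chordHeight_mem_segment {l r u v x : ℝ} (h : l < r) (hlx : l ≤ x) (hxr : x ≤ r) :
    (x, chordHeight l r u v x) ∈ segment ℝ (l, u) (r, v) := by
  have hne : r - l ≠ 0 := by linarith
  have hpos : 0 ≤ r - l := by linarith
  refine ⟨(r - x) / (r - l), (x - l) / (r - l), div_nonneg (by linarith) hpos,
    div_nonneg (by linarith) hpos, by field_simp; ring, ?_⟩
  ext
  · simp only [Prod.smul_mk, Prod.mk_add_mk, smul_eq_mul]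
    field_simp
    ring
  · simp only [Prod.smul_mk, Prod.mk_add_mk, smul_eq_mul, chordHeight]
    field_simp

theorem chordHeight_le {l r u v x M : ℝ} (h : l < r) (hlx : l ≤ x) (hxr : x ≤ r)
    (hu : u ≤ M) (hv : v ≤ M) : chordHeight l r u v x ≤ M := by
  rw [chordHeight, div_le_iff₀ (by linarith)]
  nlinarith

/-- At an interior lattice abscissa, a chord of width at most `N` has at least `1 / N` of the
height of its taller end. -/
theorem le_chordHeight {l r x : ℕ} {N u v w : ℝ} (hlx : l < x) (hxr : x < r) (hN : (r : ℝ) ≤ N)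
    (hw : 0 ≤ w) (hu : 0 ≤ u) (hv : 0 ≤ v) (huv : w * N ≤ u ∨ w * N ≤ v) :
    w ≤ chordHeight l r u v x := by
  have h1 : (l : ℝ) + 1 ≤ x := by exact_mod_cast hlx
  have h2 : (x : ℝ) + 1 ≤ r := by exact_mod_cast hxr
  have h0 : (0 : ℝ) ≤ l := Nat.cast_nonneg l
  rw [chordHeight, le_div_iff₀ (by linarith)]
  have h3 : w * (r - l) ≤ w * N := mul_le_mul_of_nonneg_left (by linarith) hw
  have h4 : 0 ≤ u * (r - x - 1) := mul_nonneg hu (by linarith)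
  have h5 : 0 ≤ v * (x - l - 1) := mul_nonneg hv (by linarith)
  rcases huv with h | h <;> linarith

theorem segment_inter_nonempty {l r u v L R U V x₀ x₁ : ℝ} (hlr : l < r) (hLR : L < R)
    (h₀ : x₀ ∈ Set.Icc l r ∩ Set.Icc L R) (h₁ : x₁ ∈ Set.Icc l r ∩ Set.Icc L R)
    (hle₀ : chordHeight l r u v x₀ ≤ chordHeight L R U V x₀)
    (hle₁ : chordHeight L R U V x₁ ≤ chordHeight l r u v x₁) :
    (segment ℝ (l, u) (r, v) ∩ segment ℝ (L, U) (R, V)).Nonempty := by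
  have hconn : IsPreconnected (Set.Icc l r ∩ Set.Icc L R) :=
    (Set.ordConnected_Icc.inter Set.ordConnected_Icc).isPreconnected
  obtain ⟨x, hx, heq⟩ := hconn.intermediate_value₂ h₀ h₁
    (continuous_chordHeight l r u v).continuousOn (continuous_chordHeight L R U V).continuousOn
    hle₀ hle₁
  refine ⟨(x, chordHeight l r u v x), mk_chordHeight_mem_segment hlr hx.1.1 hx.1.2, ?_⟩
  rw [heq]
  exact mk_chordHeight_mem_segment hLR hx.2.1 hx.2.2

theorem pow_mul_self_le_pow {N : ℝ} (hN : 1 ≤ N) {i j : ℕ} (h : i < j) : N ^ i * N ≤ N ^ j := by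
  rw [← pow_succ]
  exact pow_le_pow_right₀ hN h

theorem segment_inter_descending_nonempty {N u v : ℝ} {l r L R B t T : ℕ} (hN : 1 ≤ N)
    (hr : (r : ℝ) ≤ N) (hLR : L < R) (hlR : l < R) (hRr : R < r) (hBt : B < t) (htT : t < T)
    (hu : 0 ≤ u) (hv : 0 ≤ v) (hu' : u ≤ N ^ t) (hv' : v ≤ N ^ t)
    (huv : N ^ t ≤ u ∨ N ^ t ≤ v) :
    (segment ℝ ((l : ℝ), u) ((r : ℝ), v) ∩
      segment ℝ ((L : ℝ), N ^ T) ((R : ℝ), N ^ B)).Nonempty := by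
  have hN0 : 0 ≤ N := by linarith
  have c1 : (L : ℝ) < R := by exact_mod_cast hLR
  have c2 : (l : ℝ) < R := by exact_mod_cast hlR
  have c3 : (R : ℝ) < r := by exact_mod_cast hRr
  have hR : chordHeight L R (N ^ T) (N ^ B) R ≤ chordHeight l r u v R := by
    rw [chordHeight_right c1]
    exact le_chordHeight hlR hRr hr (pow_nonneg hN0 _) hu hv
      (huv.imp (pow_mul_self_le_pow hN hBt).trans (pow_mul_self_le_pow hN hBt).trans)
  rcases le_or_gt l L with hlL | hLl
  · have c4 : (l : ℝ) ≤ L := by exact_mod_cast hlL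
    refine segment_inter_nonempty (x₀ := L) (x₁ := R) (c2.trans c3) c1
      ⟨⟨c4, by linarith⟩, le_rfl, c1.le⟩ ⟨⟨c2.le, c3.le⟩, c1.le, le_rfl⟩ ?_ hR
    rw [chordHeight_left c1]
    exact (chordHeight_le (c2.trans c3) c4 (by linarith) hu' hv').trans
      (pow_le_pow_right₀ hN htT.le)
  · have c4 : (L : ℝ) < l := by exact_mod_cast hLl
    refine segment_inter_nonempty (x₀ := l) (x₁ := R) (c2.trans c3) c1
      ⟨⟨le_rfl, by linarith⟩, c4.le, c2.le⟩ ⟨⟨c2.le, c3.le⟩, c1.le, le_rfl⟩ ?_ hR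
    rw [chordHeight_left (c2.trans c3)]
    exact hu'.trans (le_chordHeight hLl hlR (by linarith) (pow_nonneg hN0 _) (pow_nonneg hN0 _)
      (pow_nonneg hN0 _) (Or.inl (pow_mul_self_le_pow hN htT)))

theorem segment_inter_ascending_nonempty {N u v : ℝ} {l r L R B t T : ℕ} (hN : 1 ≤ N)
    (hr : (r : ℝ) ≤ N) (hR : (R : ℝ) ≤ N) (hLR : L < R) (hlL : l < L) (hLr : L < r)
    (hBt : B < t) (htT : t < T)
    (hu : 0 ≤ u) (hv : 0 ≤ v) (hu' : u ≤ N ^ t) (hv' : v ≤ N ^ t)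
    (huv : N ^ t ≤ u ∨ N ^ t ≤ v) :
    (segment ℝ ((l : ℝ), u) ((r : ℝ), v) ∩
      segment ℝ ((L : ℝ), N ^ B) ((R : ℝ), N ^ T)).Nonempty := by
  have hN0 : 0 ≤ N := by linarith
  have c1 : (L : ℝ) < R := by exact_mod_cast hLR
  have c2 : (l : ℝ) < L := by exact_mod_cast hlL
  have c3 : (L : ℝ) < r := by exact_mod_cast hLr
  have hL : chordHeight L R (N ^ B) (N ^ T) L ≤ chordHeight l r u v L := by
    rw [chordHeight_left c1]
    exact le_chordHeight hlL hLr hr (pow_nonneg hN0 _) hu hv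
      (huv.imp (pow_mul_self_le_pow hN hBt).trans (pow_mul_self_le_pow hN hBt).trans)
  rcases le_or_gt R r with hRr | hrR
  · have c4 : (R : ℝ) ≤ r := by exact_mod_cast hRr
    refine segment_inter_nonempty (x₀ := R) (x₁ := L) (c2.trans c3) c1
      ⟨⟨by linarith, c4⟩, c1.le, le_rfl⟩ ⟨⟨c2.le, c3.le⟩, le_rfl, c1.le⟩ ?_ hL
    rw [chordHeight_right c1]
    exact (chordHeight_le (c2.trans c3) (by linarith) c4 hu' hv').trans
      (pow_le_pow_right₀ hN htT.le)
  · have c4 : (r : ℝ) < R := by exact_mod_cast hrR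
    refine segment_inter_nonempty (x₀ := r) (x₁ := L) (c2.trans c3) c1
      ⟨⟨by linarith, le_rfl⟩, c3.le, c4.le⟩ ⟨⟨c2.le, c3.le⟩, le_rfl, c1.le⟩ ?_ hL
    rw [chordHeight_right (c2.trans c3)]
    exact hv'.trans (le_chordHeight hLr hrR hR (pow_nonneg hN0 _) (pow_nonneg hN0 _)
      (pow_nonneg hN0 _) (Or.inr (pow_mul_self_le_pow hN htT)))

theorem mem_top_or_mem_side {l b r t : ℝ} (hlr : l ≤ r) (hbt : b ≤ t) {σ : Bool} {p : ℝ × ℝ}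
    (hp : p ∈ if σ then rotL' l b r t else rotL l b r t) :
    (p.2 = t ∧ l ≤ p.1 ∧ p.1 ≤ r) ∨ (p.1 = (if σ then l else r) ∧ b ≤ p.2 ∧ p.2 ≤ t) := by
  have top : p ∈ segment ℝ (l, t) (r, t) → p.2 = t ∧ l ≤ p.1 ∧ p.1 ≤ r := fun h => by
    obtain ⟨h1, h2⟩ := segment_subset_Icc (Prod.mk_le_mk.2 ⟨hlr, le_rfl⟩) h
    exact ⟨le_antisymm h2.2 h1.2, h1.1, h2.1⟩
  have side (x : ℝ) : p ∈ segment ℝ (x, b) (x, t) → p.1 = x ∧ b ≤ p.2 ∧ p.2 ≤ t := fun h => by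
    obtain ⟨h1, h2⟩ := segment_subset_Icc (Prod.mk_le_mk.2 ⟨le_rfl, hbt⟩) h
    exact ⟨le_antisymm h2.1 h1.1, h1.2, h2.2⟩
  cases σ
  · exact Or.imp top (side r) hp
  · exact Or.imp top (side l) hp

theorem diagonals_inter_nonempty_of_top_crosses_side {n l b r t L B R T : ℕ} (hn : 1 ≤ n)
    (hr : r ≤ 2 * n - 1) (hR : R ≤ 2 * n - 1) (hbt : b < t) (hLR : L < R) {σ τ : Bool}
    (hlx : l < if τ then L else R) (hxr : (if τ then L else R) < r) (hBt : B < t) (htT : t < T) :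
    ((if σ then Un n l b r t else Dn n l b r t) ∩
      (if τ then Un n L B R T else Dn n L B R T)).Nonempty := by
  have hN : (1 : ℝ) ≤ 2 * n := by exact_mod_cast (by omega : 1 ≤ 2 * n)
  have hrN : (r : ℝ) ≤ 2 * n := by exact_mod_cast (by omega : r ≤ 2 * n)
  have hRN : (R : ℝ) ≤ 2 * n := by exact_mod_cast (by omega : R ≤ 2 * n)
  have hpos (i : ℕ) : (0 : ℝ) ≤ (2 * n) ^ i := by positivity
  have hle : ((2 : ℝ) * n) ^ b ≤ (2 * n) ^ t := pow_le_pow_right₀ hN hbt.le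
  cases τ
  · cases σ
    · exact segment_inter_descending_nonempty hN hrN hLR hlx hxr hBt htT
        (hpos t) (hpos b) le_rfl hle (Or.inl le_rfl)
    · exact segment_inter_descending_nonempty hN hrN hLR hlx hxr hBt htT
        (hpos b) (hpos t) hle le_rfl (Or.inr le_rfl)
  · cases σ
    · exact segment_inter_ascending_nonempty hN hrN hRN hLR hlx hxr hBt htT
        (hpos t) (hpos b) le_rfl hle (Or.inl le_rfl)
    · exact segment_inter_ascending_nonempty hN hrN hRN hLR hlx hxr hBt htT
        (hpos b) (hpos t) hle le_rfl (Or.inr le_rfl)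

theorem diagonals_intersect_of_edge
    (n : ℕ) (hn : 1 ≤ n) (l b r t L B R T : ℕ)
    (hl : l ≤ 2*n - 1) (hb : b ≤ 2*n - 1) (hr : r ≤ 2*n - 1) (ht : t ≤ 2*n - 1)
    (hL : L ≤ 2*n - 1) (hB : B ≤ 2*n - 1) (hR : R ≤ 2*n - 1) (hT : T ≤ 2*n - 1)
    (hlr : l < r) (hbt : b < t) (hLR : L < R) (hBT : B < T)
    (hx : ([l, r, L, R] : List ℕ).Pairwise (· ≠ ·))
    (hy : ([b, t, B, T] : List ℕ).Pairwise (· ≠ ·))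
    (σ τ : Bool)
    (h : ((if σ then rotL' (l:ℝ) (b:ℝ) (r:ℝ) (t:ℝ) else rotL (l:ℝ) (b:ℝ) (r:ℝ) (t:ℝ)) ∩
          (if τ then rotL' (L:ℝ) (B:ℝ) (R:ℝ) (T:ℝ) else rotL (L:ℝ) (B:ℝ) (R:ℝ) (T:ℝ))).Nonempty) :
    ((if σ then Un n l b r t else Dn n l b r t) ∩
     (if τ then Un n L B R T else Dn n L B R T)).Nonempty := by
  simp only [List.pairwise_cons, List.mem_cons, List.not_mem_nil, or_false, forall_eq_or_imp,
    forall_eq] at hx hy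
  obtain ⟨p, hp, hq⟩ := h
  rcases mem_top_or_mem_side (by exact_mod_cast hlr.le) (by exact_mod_cast hbt.le) hp with
      ⟨h1, h2, h3⟩ | ⟨h1, h2, h3⟩ <;>
    rcases mem_top_or_mem_side (by exact_mod_cast hLR.le) (by exact_mod_cast hBT.le) hq with
      ⟨h4, h5, h6⟩ | ⟨h4, h5, h6⟩
  · have : t = T := by exact_mod_cast h1.symm.trans h4
    omega
  · rw [h4] at h2 h3
    rw [h1] at h5 h6
    norm_cast at h2 h3 h5 h6
    apply diagonals_inter_nonempty_of_top_crosses_side hn hr hR hbt hLR <;> grind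
  · rw [h1] at h5 h6
    rw [h4] at h2 h3
    norm_cast at h2 h3 h5 h6
    rw [Set.inter_comm]
    apply diagonals_inter_nonempty_of_top_crosses_side hn hR hr hBT hlr <;> grind
  · have : (if σ then l else r) = if τ then L else R := by exact_mod_cast h1.symm.trans h4
    grind
end

section
/- Let n ≥ 1 be a natural number and let ℓ, b, r, t be natural numbers with ℓ < r ≤ 2n−1 and b < t ≤ 2n−1. Then the point of the downward diagonal Dₙ(ℓ,b,r,t) whose first coordinate equals r − 1 has second coordinate (2n)^b + ((2n)^t − (2n)^b)/(r − ℓ), and this value is strictly greater than (2n)^{t−1}. -/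
theorem diagonal_y_at_r_sub_one
    (n l b r t : ℕ) (hn : 1 ≤ n)
    (hlr : l < r) (hr : r ≤ 2*n - 1) (hbt : b < t) (ht : t ≤ 2*n - 1) :
    (∃ p ∈ Dn n l b r t, p.1 = (r:ℝ) - 1) ∧
    (∀ p ∈ Dn n l b r t, p.1 = (r:ℝ) - 1 →
      p.2 = (2 * (n:ℝ))^b + ((2 * (n:ℝ))^t - (2 * (n:ℝ))^b) / ((r:ℝ) - (l:ℝ))) ∧
    (2 * (n:ℝ))^b + ((2 * (n:ℝ))^t - (2 * (n:ℝ))^b) / ((r:ℝ) - (l:ℝ)) > (2 * (n:ℝ))^(t-1) := by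
  have hd : (1:ℝ) ≤ (r:ℝ) - l := by
    have : (l:ℝ) + 1 ≤ r := by exact_mod_cast hlr
    linarith
  have hd0 : (0:ℝ) < (r:ℝ) - l := by linarith
  refine ⟨?_, ?_, ?_⟩
  · refine ⟨_, ⟨1 / ((r:ℝ) - l), 1 - 1 / ((r:ℝ) - l), by positivity, ?_, by ring, rfl⟩, ?_⟩
    · rw [sub_nonneg, div_le_one hd0]
      exact hd
    · simp only [Prod.fst_add, Prod.smul_fst, smul_eq_mul]
      field_simp
      ring
  · rintro p ⟨a, c, -, -, hac, rfl⟩ hp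
    simp only [Prod.fst_add, Prod.smul_fst, Prod.snd_add, Prod.smul_snd, smul_eq_mul] at hp ⊢
    obtain rfl : c = 1 - a := by linarith
    have ha : a = 1 / ((r:ℝ) - l) := by
      rw [eq_div_iff hd0.ne']
      linarith
    rw [ha]
    ring
  · have hdn : (r:ℝ) - l + 1 ≤ 2 * n := by
      have h : r + 1 ≤ 2 * n := by omega
      have h' : (r:ℝ) + 1 ≤ 2 * n := by exact_mod_cast h
      have : (0:ℝ) ≤ l := l.cast_nonneg
      linarith
    have hn0 : (0:ℝ) < 2 * n := by linarith
    have hpow : (2 * (n:ℝ)) ^ t = (2 * n) * (2 * (n:ℝ)) ^ (t - 1) := by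
      rw [← pow_succ', Nat.sub_add_cancel (by omega)]
    have hb : (0:ℝ) < (2 * (n:ℝ)) ^ b := by positivity
    have htp : (0:ℝ) < (2 * (n:ℝ)) ^ (t - 1) := by positivity
    rw [gt_iff_lt, ← sub_lt_iff_lt_add', lt_div_iff₀ hd0, hpow]
    nlinarith [mul_le_mul_of_nonneg_right hdn htp.le, mul_le_mul_of_nonneg_right hd hb.le]
end

section
/- Let n ≥ 1 be a natural number and let ℓ, b, r, t, L, B, R, T be natural numbers with ℓ < r ≤ 2n−1, b < t ≤ 2n−1, L ≤ R < r and B ≤ T < t. Then the downward diagonal Dₙ(ℓ,b,r,t) is disjoint from the rectangle [L,R] × [(2n)^B, (2n)^T] (the set of points (x,y) with L ≤ x ≤ R and (2n)^B ≤ y ≤ (2n)^T). -/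
theorem diagonal_disjoint_rectangle
    (n l b r t L B R T : ℕ) (hn : 1 ≤ n)
    (hlr : l < r) (hr : r ≤ 2*n - 1) (hbt : b < t) (ht : t ≤ 2*n - 1)
    (hLR : L ≤ R) (hRr : R < r) (hBT : B ≤ T) (hTt : T < t) :
    Disjoint (Dn n l b r t)
      {p : ℝ × ℝ | (L:ℝ) ≤ p.1 ∧ p.1 ≤ (R:ℝ) ∧
        (2 * (n:ℝ))^B ≤ p.2 ∧ p.2 ≤ (2 * (n:ℝ))^T} := by
  rw [Set.disjoint_left]
  rintro p ⟨a, c, ha, hc, hac, rfl⟩ ⟨-, hx, -, hy⟩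
  simp only [Prod.smul_mk, Prod.mk_add_mk, smul_eq_mul] at hx hy
  have hN : (2:ℝ) ≤ 2 * (n:ℝ) := by exact_mod_cast (by omega : 2 ≤ 2 * n)
  have hRr' : (R:ℝ) + 1 ≤ r := by exact_mod_cast hRr
  have hr' : (r:ℝ) + 1 ≤ 2 * (n:ℝ) := by exact_mod_cast (by omega : r + 1 ≤ 2 * n)
  have hl : (0:ℝ) ≤ l := l.cast_nonneg
  have hgap : 1 ≤ a * ((r:ℝ) - l) := by
    obtain rfl : c = 1 - a := by linarith
    linarith
  have ha_pos : 0 < a := by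
    rcases ha.eq_or_lt with rfl | h
    · norm_num at hgap
    · exact h
  have haN : 1 < a * (2 * (n:ℝ)) := by
    have : a * ((r:ℝ) - l) < a * (2 * (n:ℝ)) := by gcongr; linarith
    linarith
  have hpow : (2 * (n:ℝ)) ^ T * (2 * (n:ℝ)) ≤ (2 * (n:ℝ)) ^ t := by
    rw [← pow_succ]
    exact pow_le_pow_right₀ (by linarith) hTt
  have hT : 0 < (2 * (n:ℝ)) ^ T := by positivity
  have hb : 0 ≤ c * (2 * (n:ℝ)) ^ b := by positivity
  have h₁ := mul_le_mul_of_nonneg_left hpow ha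
  have h₂ := mul_lt_mul_of_pos_left haN hT
  linarith
end

section
/- Let φ, ψ : ℝ → ℝ be strictly monotone increasing functions, and let ℓ, b, r, t, L, B, R, T be real numbers with ℓ < r, b < t, L < R, B < T (so that also φ(ℓ) < φ(r), ψ(b) < ψ(t), φ(L) < φ(R), ψ(B) < ψ(T)). Then C(φ(ℓ), ψ(b), φ(r), ψ(t)) ∩ C(φ(L), ψ(B), φ(R), ψ(T)) ≠ ∅ if and only if C(ℓ,b,r,t) ∩ C(L,B,R,T) ≠ ∅; that is, whether two rotated-L curves intersect depends only on the relative order of their defining coordinates. -/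
theorem mem_rotL {l b r t : ℝ} (hlr : l ≤ r) (hbt : b ≤ t) (p : ℝ × ℝ) :
    p ∈ rotL l b r t ↔
      (l ≤ p.1 ∧ p.1 ≤ r ∧ p.2 = t) ∨ (p.1 = r ∧ b ≤ p.2 ∧ p.2 ≤ t) := by
  obtain ⟨x, y⟩ := p
  rw [rotL, ← Prod.image_mk_segment_left, ← Prod.image_mk_segment_right,
    segment_eq_Icc hlr, segment_eq_Icc hbt]
  simp only [Set.mem_union, Set.mem_image, Set.mem_Icc, Prod.mk.injEq]
  grind

/-- Two rotated-L curves meet iff their top sides, their right sides, or a top side of one and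
the right side of the other meet. -/
theorem rotL_inter_nonempty_iff_s13 {l b r t L B R T : ℝ}
    (hlr : l ≤ r) (hbt : b ≤ t) (hLR : L ≤ R) (hBT : B ≤ T) :
    (rotL l b r t ∩ rotL L B R T).Nonempty ↔
      (t = T ∧ l ≤ R ∧ L ≤ r) ∨ (l ≤ R ∧ R ≤ r ∧ B ≤ t ∧ t ≤ T) ∨
      (L ≤ r ∧ r ≤ R ∧ b ≤ T ∧ T ≤ t) ∨ (r = R ∧ b ≤ T ∧ B ≤ t) := by
  simp only [Set.Nonempty, Set.mem_inter_iff, mem_rotL hlr hbt, mem_rotL hLR hBT]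
  constructor
  · rintro ⟨⟨x, y⟩, h, h'⟩
    grind
  · rintro (⟨rfl, h₁, h₂⟩ | ⟨h₁, h₂, h₃, h₄⟩ | ⟨h₁, h₂, h₃, h₄⟩ | ⟨rfl, h₁, h₂⟩)
    · exact ⟨(max l L, t), .inl ⟨le_max_left _ _, max_le hlr h₂, rfl⟩,
        .inl ⟨le_max_right _ _, max_le h₁ hLR, rfl⟩⟩
    · exact ⟨(R, t), .inl ⟨h₁, h₂, rfl⟩, .inr ⟨rfl, h₃, h₄⟩⟩
    · exact ⟨(r, T), .inr ⟨rfl, h₃, h₄⟩, .inl ⟨h₁, h₂, rfl⟩⟩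
    · exact ⟨(r, max b B), .inr ⟨rfl, le_max_left _ _, max_le hbt h₂⟩,
        .inr ⟨rfl, le_max_right _ _, max_le h₁ hBT⟩⟩

theorem rotL_intersect_order_invariant
    (φ ψ : ℝ → ℝ) (hφ : StrictMono φ) (hψ : StrictMono ψ)
    (l b r t L B R T : ℝ)
    (hlr : l < r) (hbt : b < t) (hLR : L < R) (hBT : B < T) :
    (rotL (φ l) (ψ b) (φ r) (ψ t) ∩ rotL (φ L) (ψ B) (φ R) (ψ T)).Nonempty ↔
      (rotL l b r t ∩ rotL L B R T).Nonempty := by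
  rw [rotL_inter_nonempty_iff_s13 (hφ hlr).le (hψ hbt).le (hφ hLR).le (hψ hBT).le,
    rotL_inter_nonempty_iff_s13 hlr.le hbt.le hLR.le hBT.le]
  simp only [hφ.le_iff_le, hψ.le_iff_le, hφ.injective.eq_iff, hψ.injective.eq_iff]
end
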